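/- There exist ε₀ > 0 and C > 0, depending only on n, σ₀ and finitely many of the constants A_ℓ, such that for every ε ∈ (0, ε₀) and every (x,ξ) ∈ ℝⁿ × ℝⁿ with 1/2 ≤ |ξ| ≤ 2: (i) the function s ↦ ⟨x(s,x,ξ)⟩^{−(1+σ₀)} is integrable on ℝ; (ii) for all t ∈ ℝ, |x(t,x,ξ) − x − 2tξ| ≤ C ε ⟨t⟩ and |ξ(t,x,ξ) − ξ| ≤ C ε. -/

import Mathlib

open MeasureTheory Set
open scoped BigOperators

noncomputable section

namespace Paper

/-- `ℝⁿ` with the Euclidean norm. -/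
abbrev Eu (n : ℕ) := EuclideanSpace ℝ (Fin n)

/-- The Japanese bracket `⟨x⟩ = (1 + |x|²)^{1/2}`. -/
def jb {n : ℕ} (x : Eu n) : ℝ := Real.sqrt (1 + ‖x‖ ^ 2)

/-- `⟨t⟩ = (1 + t²)^{1/2}` for a real number `t`. -/
def jbr (t : ℝ) : ℝ := Real.sqrt (1 + t ^ 2)

/-- The dot product `x·ξ` on `ℝⁿ`. -/
def dotp {n : ℕ} (x ξ : Eu n) : ℝ := ∑ j, x j * ξ j

/-- First-order partial derivative `∂/∂xᵢ`. -/
def pd {n : ℕ} (i : Fin n) (f : Eu n → ℝ) : Eu n → ℝ :=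
  fun x => fderiv ℝ f x (EuclideanSpace.single i 1)

/-- The list of coordinate directions attached to a multi-index `γ`. -/
def mIdx {n : ℕ} (γ : Fin n → ℕ) : List (Fin n) :=
  (List.finRange n).foldr (fun i acc => List.replicate (γ i) i ++ acc) []

/-- The multi-index partial derivative `∂^γ` of a function on `ℝⁿ`. -/
def mderiv {n : ℕ} (γ : Fin n → ℕ) (f : Eu n → ℝ) : Eu n → ℝ :=
  (mIdx γ).foldr pd f

/-- The order `|γ|` of a multi-index. -/
def mOrd {n : ℕ} (γ : Fin n → ℕ) : ℕ := ∑ i, γ i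

/-- Partial derivative in the first group of variables of a function `f(x,ξ)`. -/
def pdX {n : ℕ} (i : Fin n) (f : Eu n → Eu n → ℝ) : Eu n → Eu n → ℝ :=
  fun x ξ => fderiv ℝ (fun y => f y ξ) x (EuclideanSpace.single i 1)

/-- Partial derivative in the second group of variables of a function `f(x,ξ)`. -/
def pdXi {n : ℕ} (i : Fin n) (f : Eu n → Eu n → ℝ) : Eu n → Eu n → ℝ :=
  fun x ξ => fderiv ℝ (fun η => f x η) ξ (EuclideanSpace.single i 1)

/-- The mixed multi-index derivative `∂_x^A ∂_ξ^B` of a function `f(x,ξ)`. -/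
def mderiv2 {n : ℕ} (A B : Fin n → ℕ) (f : Eu n → Eu n → ℝ) : Eu n → Eu n → ℝ :=
  (mIdx A).foldr pdX ((mIdx B).foldr pdXi f)

open scoped Gradient RealInnerProductSpace

theorem one_le_jb {n : ℕ} (x : Eu n) : 1 ≤ jb x := by
  unfold jb
  rw [Real.one_le_sqrt]
  nlinarith [sq_nonneg ‖x‖]

theorem norm_le_jb {n : ℕ} (x : Eu n) : ‖x‖ ≤ jb x :=
  Real.le_sqrt_of_sq_le (by linarith)

theorem one_le_jbr (t : ℝ) : 1 ≤ jbr t := by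
  unfold jbr
  rw [Real.one_le_sqrt]
  nlinarith [sq_nonneg t]

theorem abs_le_jbr (t : ℝ) : |t| ≤ jbr t :=
  Real.le_sqrt_of_sq_le (by rw [sq_abs]; linarith)

theorem continuous_jbr : Continuous jbr := by
  unfold jbr
  fun_prop

theorem mIdx_single {n : ℕ} (i : Fin n) : mIdx (Pi.single i 1) = [i] := by
  have key : ∀ l : List (Fin n), l.Nodup →
      l.foldr (fun j acc => List.replicate ((Pi.single i 1 : Fin n → ℕ) j) j ++ acc) [] =
        if i ∈ l then [i] else [] := by
    intro l
    induction l with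
    | nil => simp
    | cons a l ih =>
      intro h
      rw [List.nodup_cons] at h
      rw [List.foldr_cons, ih h.2]
      by_cases hia : i = a
      · subst hia
        simp [h.1]
      · simp [hia, Ne.symm hia]
  simpa [mIdx] using key _ (List.nodup_finRange n)

theorem mderiv_single {n : ℕ} (i : Fin n) (f : Eu n → ℝ) :
    mderiv (Pi.single i 1) f = pd i f := by
  simp [mderiv, mIdx_single]

theorem mderiv_zero {n : ℕ} (f : Eu n → ℝ) : mderiv 0 f = f := by
  have : mIdx (0 : Fin n → ℕ) = [] := by
    simp [mIdx]
  simp [mderiv, this]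

theorem sum_pd_le_sum_mderiv {n : ℕ} (b : Fin n → Fin n → Eu n → ℝ) (x : Eu n) :
    ∑ i, ∑ j, ∑ k, |pd i (b j k) x| ≤
      ∑ γ ∈ Finset.Nat.antidiagonalTuple n 1, ∑ j, ∑ k, |mderiv γ (b j k) x| := by
  classical
  have hinj : Function.Injective (fun i : Fin n => (Pi.single i 1 : Fin n → ℕ)) := by
    intro i j h
    by_contra hij
    have := congrFun h i
    simp [hij] at this
  calc ∑ i, ∑ j, ∑ k, |pd i (b j k) x|
      = ∑ γ ∈ Finset.univ.image (fun i : Fin n => (Pi.single i 1 : Fin n → ℕ)),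
          ∑ j, ∑ k, |mderiv γ (b j k) x| := by
        rw [Finset.sum_image fun _ _ _ _ h => hinj h]
        simp only [mderiv_single]
    _ ≤ _ := by
        refine Finset.sum_le_sum_of_subset_of_nonneg ?_ fun _ _ _ => by positivity
        intro γ hγ
        obtain ⟨i, -, rfl⟩ := Finset.mem_image.1 hγ
        simp [Finset.Nat.mem_antidiagonalTuple]

theorem abs_coord_le_norm {n : ℕ} (x : Eu n) (i : Fin n) : |x i| ≤ ‖x‖ := by
  simpa using PiLp.norm_apply_le x i

/-- The quadratic form `q(x,ξ) = Σ b_{jk}(x) ξ_j ξ_k`. -/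
def quadForm {n : ℕ} (b : Fin n → Fin n → Eu n → ℝ) (x ξ : Eu n) : ℝ :=
  ∑ j, ∑ k, b j k x * ξ j * ξ k

theorem abs_quadForm_le {n : ℕ} (b : Fin n → Fin n → Eu n → ℝ) (x ξ : Eu n) :
    |quadForm b x ξ| ≤ (∑ j, ∑ k, |b j k x|) * ‖ξ‖ ^ 2 := by
  simp only [quadForm, Finset.sum_mul]
  refine (Finset.abs_sum_le_sum_abs _ _).trans (Finset.sum_le_sum fun j _ => ?_)
  refine (Finset.abs_sum_le_sum_abs _ _).trans (Finset.sum_le_sum fun k _ => ?_)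
  rw [abs_mul, abs_mul, mul_assoc, pow_two]
  gcongr <;> exact abs_coord_le_norm _ _

theorem fderiv_eq_sum_pd {n : ℕ} (f : Eu n → ℝ) (x v : Eu n) :
    fderiv ℝ f x v = ∑ i, v i * pd i f x := by
  conv_lhs => rw [← (EuclideanSpace.basisFun (Fin n) ℝ).sum_repr v]
  simp [pd, map_sum]

theorem abs_fderiv_le {n : ℕ} (f : Eu n → ℝ) (x v : Eu n) :
    |fderiv ℝ f x v| ≤ (∑ i, |pd i f x|) * ‖v‖ := by
  rw [fderiv_eq_sum_pd, Finset.sum_mul]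
  refine (Finset.abs_sum_le_sum_abs _ _).trans (Finset.sum_le_sum fun i _ => ?_)
  rw [abs_mul, mul_comm]
  gcongr
  exact abs_coord_le_norm _ _

theorem hasFDerivAt_coord {n : ℕ} (i : Fin n) (ξ : Eu n) :
    HasFDerivAt (fun η : Eu n => η i) (EuclideanSpace.proj i : Eu n →L[ℝ] ℝ) ξ :=
  (EuclideanSpace.proj i : Eu n →L[ℝ] ℝ).hasFDerivAt

theorem fderiv_quadForm_right {n : ℕ} (b : Fin n → Fin n → Eu n → ℝ) (x ξ v : Eu n) :
    fderiv ℝ (quadForm b x) ξ v =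
      ∑ j, ∑ k, b j k x * (v j * ξ k + ξ j * v k) := by
  have h : HasFDerivAt (quadForm b x) (∑ j, ∑ k,
      ((b j k x * ξ j) • (EuclideanSpace.proj k : Eu n →L[ℝ] ℝ) +
        ξ k • (b j k x • (EuclideanSpace.proj j : Eu n →L[ℝ] ℝ)))) ξ := by
    refine HasFDerivAt.fun_sum fun j _ => HasFDerivAt.fun_sum fun k _ => ?_
    exact ((hasFDerivAt_coord j ξ).const_mul (b j k x)).mul (hasFDerivAt_coord k ξ)
  rw [h.fderiv]
  simp only [sum_apply, add_apply, smul_apply, smul_eq_mul, PiLp.proj_apply]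
  refine Finset.sum_congr rfl fun j _ => Finset.sum_congr rfl fun k _ => by ring

theorem fderiv_quadForm_left {n : ℕ} {b : Fin n → Fin n → Eu n → ℝ}
    (hb : ∀ j k, Differentiable ℝ (b j k)) (x ξ v : Eu n) :
    fderiv ℝ (fun y => quadForm b y ξ) x v =
      ∑ j, ∑ k, fderiv ℝ (b j k) x v * ξ j * ξ k := by
  have h : HasFDerivAt (fun y => quadForm b y ξ)
      (∑ j, ∑ k, ξ k • (ξ j • fderiv ℝ (b j k) x)) x := by
    refine HasFDerivAt.fun_sum fun j _ => HasFDerivAt.fun_sum fun k _ => ?_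
    exact ((hb j k x).hasFDerivAt.mul_const (ξ j)).mul_const (ξ k)
  rw [h.fderiv]
  simp only [sum_apply, smul_apply, smul_eq_mul]
  refine Finset.sum_congr rfl fun j _ => Finset.sum_congr rfl fun k _ => by ring

theorem fderiv_quadForm_right_self {n : ℕ} (b : Fin n → Fin n → Eu n → ℝ) (x ξ : Eu n) :
    fderiv ℝ (quadForm b x) ξ ξ = 2 * quadForm b x ξ := by
  rw [fderiv_quadForm_right, quadForm]
  simp only [Finset.mul_sum]
  refine Finset.sum_congr rfl fun j _ => Finset.sum_congr rfl fun k _ => by ring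

theorem norm_gradient_le_of_abs_fderiv_le {n : ℕ} {f : Eu n → ℝ} {x : Eu n} {M : ℝ}
    (hM : 0 ≤ M) (h : ∀ v, |fderiv ℝ f x v| ≤ M * ‖v‖) : ‖∇ f x‖ ≤ M := by
  rw [gradient, LinearIsometryEquiv.norm_map]
  exact ContinuousLinearMap.opNorm_le_bound _ hM h

theorem norm_gradient_quadForm_right_le {n : ℕ} (b : Fin n → Fin n → Eu n → ℝ) (x ξ : Eu n) :
    ‖∇ (quadForm b x) ξ‖ ≤ (∑ j, ∑ k, |b j k x|) * (2 * ‖ξ‖) := by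
  refine norm_gradient_le_of_abs_fderiv_le (by positivity) fun v => ?_
  rw [fderiv_quadForm_right, mul_assoc, Finset.sum_mul]
  refine (Finset.abs_sum_le_sum_abs _ _).trans (Finset.sum_le_sum fun j _ => ?_)
  rw [Finset.sum_mul]
  refine (Finset.abs_sum_le_sum_abs _ _).trans (Finset.sum_le_sum fun k _ => ?_)
  rw [abs_mul]
  gcongr
  calc |v j * ξ k + ξ j * v k| ≤ |v j| * |ξ k| + |ξ j| * |v k| := by
        rw [← abs_mul, ← abs_mul]; exact abs_add_le _ _
    _ ≤ ‖v‖ * ‖ξ‖ + ‖ξ‖ * ‖v‖ := by gcongr <;> exact abs_coord_le_norm _ _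
    _ = 2 * ‖ξ‖ * ‖v‖ := by ring

theorem norm_gradient_quadForm_left_le {n : ℕ} {b : Fin n → Fin n → Eu n → ℝ}
    (hb : ∀ j k, Differentiable ℝ (b j k)) (x ξ : Eu n) :
    ‖∇ (fun y => quadForm b y ξ) x‖ ≤ (∑ i, ∑ j, ∑ k, |pd i (b j k) x|) * ‖ξ‖ ^ 2 := by
  refine norm_gradient_le_of_abs_fderiv_le (by positivity) fun v => ?_
  rw [fderiv_quadForm_left hb]
  have hsum : ∑ i, ∑ j, ∑ k, |pd i (b j k) x| = ∑ j, ∑ k, ∑ i, |pd i (b j k) x| := by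
    rw [Finset.sum_comm]
    exact Finset.sum_congr rfl fun j _ => Finset.sum_comm
  rw [hsum, mul_assoc, Finset.sum_mul]
  refine (Finset.abs_sum_le_sum_abs _ _).trans (Finset.sum_le_sum fun j _ => ?_)
  rw [Finset.sum_mul]
  refine (Finset.abs_sum_le_sum_abs _ _).trans (Finset.sum_le_sum fun k _ => ?_)
  calc |fderiv ℝ (b j k) x v * ξ j * ξ k|
      = |fderiv ℝ (b j k) x v| * |ξ j| * |ξ k| := by rw [abs_mul, abs_mul]
    _ ≤ ((∑ i, |pd i (b j k) x|) * ‖v‖) * ‖ξ‖ * ‖ξ‖ := by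
        gcongr
        · exact abs_fderiv_le _ _ _
        · exact abs_coord_le_norm _ _
        · exact abs_coord_le_norm _ _
    _ = _ := by ring

theorem gradient_apply {n : ℕ} (f : Eu n → ℝ) (x : Eu n) (j : Fin n) :
    ∇ f x j = fderiv ℝ f x (EuclideanSpace.single j 1) := by
  rw [← inner_gradient_left, EuclideanSpace.inner_single_right]
  simp

/-- A curve whose derivative is bounded by `c + h`, with `h ≥ 0` integrable, moves by at most
`c |b - a| + ∫ h` between the times `a` and `b`. -/
theorem norm_sub_le_of_norm_deriv_le_add_integrable {E : Type*} [NormedAddCommGroup E]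
    [NormedSpace ℝ E] {f f' : ℝ → E} {h : ℝ → ℝ} {c : ℝ} (hf : ∀ t, HasDerivAt f (f' t) t)
    (hc : Continuous h) (hi : Integrable h) (h0 : ∀ t, 0 ≤ h t)
    (hb : ∀ t, ‖f' t‖ ≤ c + h t) (a b : ℝ) :
    ‖f b - f a‖ ≤ c * |b - a| + ∫ t, h t := by
  wlog hab : a ≤ b generalizing a b
  · rw [norm_sub_rev, abs_sub_comm]
    exact this b a (le_of_not_ge hab)
  have hB : ∀ t, HasDerivAt (fun t => c * (t - a) + ∫ s in a..t, h s) (c + h t) t := by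
    intro t
    have h1 : HasDerivAt (fun t => c * (t - a)) c t := by
      simpa using ((hasDerivAt_id t).sub_const a).const_mul c
    exact h1.add (intervalIntegral.integral_hasDerivAt_right (hc.intervalIntegrable _ _)
      (hc.stronglyMeasurableAtFilter _ _) hc.continuousAt)
  have key : ‖f b - f a‖ ≤ c * (b - a) + ∫ s in a..b, h s :=
    image_norm_le_of_norm_deriv_right_le_deriv_boundary (f := fun t => f t - f a) (f' := f')
      (a := a) (b := b)
      (fun t _ => ((hf t).sub_const _).continuousAt.continuousWithinAt)
      (fun t _ => ((hf t).sub_const _).hasDerivWithinAt)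
      (by simp) hB (fun t _ => hb t) (right_mem_Icc.2 hab)
  rw [abs_of_nonneg (sub_nonneg.2 hab)]
  refine key.trans (add_le_add_right ?_ _)
  rw [intervalIntegral.integral_of_le hab]
  exact setIntegral_le_integral hi (Filter.Eventually.of_forall h0)

/-- If the derivative of `g` is at least `c > 0`, then `g` vanishes at some `t₀` and grows at
least linearly away from it. -/
theorem exists_mul_abs_sub_le_of_le_deriv {g g' : ℝ → ℝ} {c : ℝ} (hc : 0 < c)
    (hg : ∀ t, HasDerivAt g (g' t) t) (hg' : ∀ t, c ≤ g' t) :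
    ∃ t₀, ∀ t, c * |t - t₀| ≤ |g t| := by
  have hd : Differentiable ℝ g := fun t => (hg t).differentiableAt
  have mono : ∀ s t, s ≤ t → c * (t - s) ≤ g t - g s := fun s t hst =>
    mul_sub_le_image_sub_of_le_deriv hd (fun t => by rw [(hg t).deriv]; exact hg' t) hst
  set T := |g 0| / c with hT
  have hT0 : 0 ≤ T := by positivity
  have hcT : c * T = |g 0| := by rw [hT]; field_simp
  have h1 := mono 0 T hT0
  have h2 := mono (-T) 0 (by linarith)
  obtain ⟨t₀, -, ht₀⟩ := intermediate_value_Icc (show -T ≤ T by linarith)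
    hd.continuous.continuousOn
    (show (0 : ℝ) ∈ Icc (g (-T)) (g T) from
      ⟨by linarith [le_abs_self (g 0)], by linarith [neg_abs_le (g 0)]⟩)
  refine ⟨t₀, fun t => ?_⟩
  rcases le_total t₀ t with h | h
  · rw [abs_of_nonneg (sub_nonneg.2 h)]
    linarith [mono _ _ h, le_abs_self (g t)]
  · rw [abs_of_nonpos (sub_nonpos.2 h)]
    linarith [mono _ _ h, neg_abs_le (g t)]

theorem integrable_jbr_rpow {σ k : ℝ} (hσ : 0 < σ) (hk : k ≠ 0) :
    Integrable fun t : ℝ => jbr (k * t) ^ (-(1 + σ)) := by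
  have h : Integrable fun t : ℝ => jbr t ^ (-(1 + σ)) := by
    have := integrable_rpow_neg_one_add_norm_sq (E := ℝ) (μ := volume) (r := 1 + σ) (by simpa)
    refine this.congr (Filter.Eventually.of_forall fun t => ?_)
    simp only [jbr]
    rw [Real.sqrt_eq_rpow, ← Real.rpow_mul (by positivity), Real.norm_eq_abs, sq_abs]
    congr 1
    ring
  exact h.comp_mul_left' hk

theorem jb_rpow_le_jbr_rpow {n : ℕ} {σ s : ℝ} (hσ : 0 < σ) {x : Eu n} (h : |s| ≤ ‖x‖) :
    jb x ^ (-(1 + σ)) ≤ jbr s ^ (-(1 + σ)) := by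
  refine Real.rpow_le_rpow_of_nonpos (by linarith [one_le_jbr s]) ?_ (by linarith)
  refine Real.sqrt_le_sqrt ?_
  rw [← sq_abs s]
  gcongr

/-- The Hamiltonian `p(x,ξ) = |ξ|² + ε q(x,ξ)`. -/
def hamiltonian {n : ℕ} (b : Fin n → Fin n → Eu n → ℝ) (ε : ℝ) (x ξ : Eu n) : ℝ :=
  ‖ξ‖ ^ 2 + ε * quadForm b x ξ

theorem differentiable_quadForm {n : ℕ} {b : Fin n → Fin n → Eu n → ℝ}
    (hb : ∀ j k, Differentiable ℝ (b j k)) :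
    Differentiable ℝ fun z : Eu n × Eu n => quadForm b z.1 z.2 := by
  unfold quadForm
  fun_prop

theorem differentiable_hamiltonian {n : ℕ} {b : Fin n → Fin n → Eu n → ℝ}
    (hb : ∀ j k, Differentiable ℝ (b j k)) (ε : ℝ) :
    Differentiable ℝ fun z : Eu n × Eu n => hamiltonian b ε z.1 z.2 := by
  have := differentiable_quadForm hb
  have h2 : Differentiable ℝ fun z : Eu n × Eu n => ‖z.2‖ ^ 2 := differentiable_snd.norm_sq ℝ
  exact h2.add (this.const_mul ε)

theorem gradient_hamiltonian_right {n : ℕ} {b : Fin n → Fin n → Eu n → ℝ}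
    (hb : ∀ j k, Differentiable ℝ (b j k)) (ε : ℝ) (x ξ : Eu n) :
    ∇ (hamiltonian b ε x) ξ = (2 : ℝ) • ξ + ε • ∇ (quadForm b x) ξ := by
  have hd : DifferentiableAt ℝ (quadForm b x) ξ :=
    ((differentiable_quadForm hb).comp
      ((differentiable_const x).prodMk differentiable_id)).differentiableAt
  have h : HasFDerivAt (hamiltonian b ε x)
      ((2 : ℝ) • innerSL ℝ ξ + ε • fderiv ℝ (quadForm b x) ξ) ξ := by
    have := (hasStrictFDerivAt_norm_sq ξ).hasFDerivAt
    rw [← ofNat_smul_eq_nsmul ℝ] at this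
    exact this.add (hd.hasFDerivAt.const_mul ε)
  refine ext_inner_right ℝ fun v => ?_
  rw [inner_gradient_left, h.fderiv, inner_add_left, inner_smul_left, inner_smul_left,
    inner_gradient_left]
  simp

theorem gradient_hamiltonian_left {n : ℕ} {b : Fin n → Fin n → Eu n → ℝ}
    (hb : ∀ j k, Differentiable ℝ (b j k)) (ε : ℝ) (x ξ : Eu n) :
    ∇ (fun y => hamiltonian b ε y ξ) x = ε • ∇ (fun y => quadForm b y ξ) x := by
  have hd : DifferentiableAt ℝ (fun y => quadForm b y ξ) x :=
    ((differentiable_quadForm hb).comp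
      (differentiable_id.prodMk (differentiable_const ξ))).differentiableAt
  have h : HasFDerivAt (fun y => hamiltonian b ε y ξ)
      (ε • fderiv ℝ (fun y => quadForm b y ξ) x) x :=
    (hd.hasFDerivAt.const_mul ε).const_add _
  refine ext_inner_right ℝ fun v => ?_
  rw [inner_gradient_left, h.fderiv, inner_smul_left, inner_gradient_left]
  simp

theorem inner_gradient_hamiltonian_right_self {n : ℕ} {b : Fin n → Fin n → Eu n → ℝ}
    (hb : ∀ j k, Differentiable ℝ (b j k)) (ε : ℝ) (x ξ : Eu n) :
    ⟪∇ (hamiltonian b ε x) ξ, ξ⟫ = 2 * hamiltonian b ε x ξ := by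
  rw [gradient_hamiltonian_right hb, inner_add_left, inner_smul_left, inner_smul_left,
    inner_gradient_left, fderiv_quadForm_right_self, real_inner_self_eq_norm_sq, hamiltonian]
  simp
  ring

theorem hamiltonian_conserved {E : Type*} [NormedAddCommGroup E] [InnerProductSpace ℝ E]
    [CompleteSpace E] {p : E → E → ℝ} (hp : Differentiable ℝ fun z : E × E => p z.1 z.2)
    {X Ξ : ℝ → E} (hX : ∀ t, HasDerivAt X (∇ (p (X t)) (Ξ t)) t)
    (hΞ : ∀ t, HasDerivAt Ξ (-∇ (fun y => p y (Ξ t)) (X t)) t) (t : ℝ) :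
    p (X t) (Ξ t) = p (X 0) (Ξ 0) := by
  have hd : ∀ s, HasDerivAt (fun s => p (X s) (Ξ s)) 0 s := by
    intro s
    set L := fderiv ℝ (fun z : E × E => p z.1 z.2) (X s, Ξ s)
    have hP : HasFDerivAt (fun z : E × E => p z.1 z.2) L (X s, Ξ s) := (hp _).hasFDerivAt
    have h1 : ∀ u, ⟪∇ (fun y => p y (Ξ s)) (X s), u⟫ = L (u, 0) := by
      intro u
      have := hP.comp (X s) (hasFDerivAt_prodMk_left (𝕜 := ℝ) (X s) (Ξ s))
      rw [inner_gradient_left]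
      exact congrArg (· u) this.fderiv
    have h2 : ∀ u, ⟪∇ (p (X s)) (Ξ s), u⟫ = L (0, u) := by
      intro u
      have := hP.comp (Ξ s) (hasFDerivAt_prodMk_right (𝕜 := ℝ) (X s) (Ξ s))
      rw [inner_gradient_left]
      exact congrArg (· u) this.fderiv
    have h3 := hP.comp_hasDerivAt s ((hX s).prodMk (hΞ s))
    have h4 : ∀ u v : E, L (u, -v) = L (u, 0) - L (0, v) := by
      intro u v
      rw [← map_sub]
      simp
    rwa [h4, ← h1, ← h2, real_inner_comm, sub_self] at h3
  exact is_const_of_deriv_eq_zero (fun s => (hd s).differentiableAt) (fun s => (hd s).deriv) t 0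

theorem bicharacteristic_bounds {n : ℕ} {σ A₀ A₁ ε : ℝ} (hσ : 0 < σ)
    {b : Fin n → Fin n → Eu n → ℝ} (hb : ∀ j k, Differentiable ℝ (b j k))
    (hA₀ : ∀ x, ∑ j, ∑ k, |b j k x| ≤ A₀ * jb x ^ (-(1 + σ)))
    (hA₁ : ∀ x, ∑ i, ∑ j, ∑ k, |pd i (b j k) x| ≤ A₁ * jb x ^ (-(2 + σ)))
    (hA₀0 : 0 ≤ A₀) (hA₁0 : 0 ≤ A₁) (hε : 0 ≤ ε) (hεA₀ : ε * A₀ ≤ 1 / 10)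
    (hεA₁ : ε * A₁ ≤ 1 / 10) {X Ξ : ℝ → Eu n}
    (hX : ∀ t, HasDerivAt X (∇ (hamiltonian b ε (X t)) (Ξ t)) t)
    (hΞ : ∀ t, HasDerivAt Ξ (-∇ (fun y => hamiltonian b ε y (Ξ t)) (X t)) t)
    (hlo : 1 / 2 ≤ ‖Ξ 0‖) (hhi : ‖Ξ 0‖ ≤ 2) :
    Integrable (fun s : ℝ => jb (X s) ^ (-(1 + σ))) ∧
      (∀ t, ‖Ξ t - Ξ 0‖ ≤ 9 * A₁ * (∫ s, jbr (1 / 12 * s) ^ (-(1 + σ))) * ε) ∧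
      ∀ t, ‖X t - (X 0 + (2 * t) • Ξ 0)‖ ≤
        (18 * A₁ + 6 * A₀) * (∫ s, jbr (1 / 12 * s) ^ (-(1 + σ))) * ε * jbr t := by
  have jb_pow_le_one : ∀ x : Eu n, jb x ^ (-(1 + σ)) ≤ 1 := fun x =>
    Real.rpow_le_one_of_one_le_of_nonpos (one_le_jb x) (by linarith)
  have jb_pow_succ : ∀ x : Eu n, jb x ^ (-(2 + σ)) * jb x = jb x ^ (-(1 + σ)) := fun x => by
    rw [← Real.rpow_add_one (by linarith [one_le_jb x])]
    congr 1
    ring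
  have jb_pow_nonneg : ∀ (x : Eu n) (r : ℝ), 0 ≤ jb x ^ r := fun x r =>
    Real.rpow_nonneg (zero_le_one.trans (one_le_jb x)) _
  have hq : ∀ x ξ, |ε * quadForm b x ξ| ≤ 1 / 10 * ‖ξ‖ ^ 2 := by
    intro x ξ
    rw [abs_mul, abs_of_nonneg hε]
    calc ε * |quadForm b x ξ| ≤ ε * (A₀ * 1 * ‖ξ‖ ^ 2) := by
          gcongr
          refine (abs_quadForm_le b x ξ).trans ?_
          gcongr
          exact (hA₀ x).trans (by gcongr; exact jb_pow_le_one x)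
      _ = ε * A₀ * ‖ξ‖ ^ 2 := by ring
      _ ≤ _ := by gcongr
  have hcons : ∀ t, hamiltonian b ε (X t) (Ξ t) = hamiltonian b ε (X 0) (Ξ 0) :=
    hamiltonian_conserved (differentiable_hamiltonian hb ε) hX hΞ
  have hΞlo : ∀ t, 9 / 44 ≤ ‖Ξ t‖ ^ 2 := by
    intro t
    have h1 := hcons t
    unfold hamiltonian at h1
    have h2 := abs_le.1 (hq (X t) (Ξ t))
    have h3 := abs_le.1 (hq (X 0) (Ξ 0))
    nlinarith
  have hΞhi : ∀ t, ‖Ξ t‖ ≤ 3 := by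
    intro t
    have h1 := hcons t
    unfold hamiltonian at h1
    have h2 := abs_le.1 (hq (X t) (Ξ t))
    have h3 := abs_le.1 (hq (X 0) (Ξ 0))
    refine abs_le_of_sq_le_sq' ?_ (by norm_num) |>.2
    nlinarith [norm_nonneg (Ξ 0)]
  have hW : ∀ t, ‖∇ (fun y => quadForm b y (Ξ t)) (X t)‖ ≤
      A₁ * jb (X t) ^ (-(2 + σ)) * ‖Ξ t‖ ^ 2 := fun t =>
    (norm_gradient_quadForm_left_le hb _ _).trans (by gcongr; exact hA₁ _)
  have hg : ∀ t, HasDerivAt (fun s => ⟪X s, Ξ s⟫)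
      (⟪X t, -∇ (fun y => hamiltonian b ε y (Ξ t)) (X t)⟫ +
        ⟪∇ (hamiltonian b ε (X t)) (Ξ t), Ξ t⟫) t := fun t => (hX t).inner ℝ (hΞ t)
  obtain ⟨t₀, ht₀⟩ := exists_mul_abs_sub_le_of_le_deriv (c := 1 / 4) (by norm_num) hg (by
    intro t
    rw [inner_gradient_hamiltonian_right_self hb, gradient_hamiltonian_left hb, inner_neg_right,
      inner_smul_right]
    have h1 : |⟪X t, ∇ (fun y => quadForm b y (Ξ t)) (X t)⟫| ≤ A₁ * ‖Ξ t‖ ^ 2 := by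
      calc _ ≤ ‖X t‖ * ‖∇ (fun y => quadForm b y (Ξ t)) (X t)‖ := abs_real_inner_le_norm _ _
        _ ≤ jb (X t) * (A₁ * jb (X t) ^ (-(2 + σ)) * ‖Ξ t‖ ^ 2) := by
            gcongr
            · linarith [one_le_jb (X t)]
            · exact norm_le_jb _
            · exact hW t
        _ = A₁ * (jb (X t) ^ (-(2 + σ)) * jb (X t)) * ‖Ξ t‖ ^ 2 := by ring
        _ ≤ A₁ * 1 * ‖Ξ t‖ ^ 2 := by
            rw [jb_pow_succ]
            gcongr
            exact jb_pow_le_one _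
        _ = _ := by ring
    have h2 := mul_le_mul_of_nonneg_left (abs_le.1 h1).2 hε
    have h3 := abs_le.1 (hq (X t) (Ξ t))
    have h4 := mul_le_mul_of_nonneg_right hεA₁ (sq_nonneg ‖Ξ t‖)
    unfold hamiltonian
    linarith [hΞlo t])
  have hXlo : ∀ t, |1 / 12 * (t - t₀)| ≤ ‖X t‖ := by
    intro t
    have h1 := (ht₀ t).trans (abs_real_inner_le_norm _ _)
    have h2 := mul_le_mul_of_nonneg_left (hΞhi t) (norm_nonneg (X t))
    rw [abs_mul, abs_of_nonneg (by norm_num : (0 : ℝ) ≤ 1 / 12)]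
    linarith
  set h : ℝ → ℝ := fun t => jbr (1 / 12 * (t - t₀)) ^ (-(1 + σ))
  set K := ∫ s, jbr (1 / 12 * s) ^ (-(1 + σ))
  have hjh : ∀ t, jb (X t) ^ (-(1 + σ)) ≤ h t := fun t => jb_rpow_le_jbr_rpow hσ (hXlo t)
  have h_int : Integrable h :=
    (integrable_jbr_rpow hσ (k := 1 / 12) (by norm_num)).comp_sub_right t₀
  have h_integral : ∫ t, h t = K :=
    integral_sub_right_eq_self (fun s => jbr (1 / 12 * s) ^ (-(1 + σ))) t₀
  have h_cont : Continuous h :=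
    (continuous_jbr.comp (by fun_prop : Continuous fun t : ℝ => 1 / 12 * (t - t₀))).rpow_const
      fun t => Or.inl (by simpa using (zero_lt_one.trans_le (one_le_jbr _)).ne')
  have h_nonneg : ∀ t, 0 ≤ h t := fun t => (jb_pow_nonneg _ _).trans (hjh t)
  have hΞ' : ∀ t, ‖Ξ t - Ξ 0‖ ≤ 9 * A₁ * K * ε := by
    intro t
    have := norm_sub_le_of_norm_deriv_le_add_integrable (c := 0)
      (h := fun t => ε * (9 * A₁) * h t) hΞ (by fun_prop) (h_int.const_mul _)
      (fun t => mul_nonneg (by positivity) (h_nonneg t)) (by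
        intro s
        rw [norm_neg, gradient_hamiltonian_left hb, norm_smul, Real.norm_of_nonneg hε]
        calc ε * ‖∇ (fun y => quadForm b y (Ξ s)) (X s)‖
            ≤ ε * (A₁ * jb (X s) ^ (-(1 + σ)) * 3 ^ 2) := by
              gcongr
              refine (hW s).trans ?_
              gcongr
              · exact mul_nonneg hA₁0 (jb_pow_nonneg _ _)
              · exact one_le_jb _
              · norm_num
              · exact hΞhi s
          _ = ε * (9 * A₁) * jb (X s) ^ (-(1 + σ)) := by ring
          _ ≤ ε * (9 * A₁) * h s := by gcongr; exact hjh s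
          _ = _ := by ring) 0 t
    rw [integral_const_mul, h_integral] at this
    linarith
  refine ⟨?_, hΞ', fun t => ?_⟩
  · refine h_int.mono' ?_ (Filter.Eventually.of_forall fun t => ?_)
    · have hXc : Continuous X :=
        continuous_iff_continuousAt.2 fun t => (hX t).continuousAt
      have : Continuous fun s => jb (X s) := by
        unfold jb
        fun_prop
      exact (this.rpow_const fun t =>
        Or.inl (zero_lt_one.trans_le (one_le_jb _)).ne').aestronglyMeasurable
    · rw [Real.norm_of_nonneg (jb_pow_nonneg _ _)]
      exact hjh t
  · have hY : ∀ s, HasDerivAt (fun s => X s - (X 0 + (2 * s) • Ξ 0))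
        (∇ (hamiltonian b ε (X s)) (Ξ s) - (2 : ℝ) • Ξ 0) s := by
      intro s
      have h1 : HasDerivAt (fun s : ℝ => (2 * s) • Ξ 0) ((2 : ℝ) • Ξ 0) s := by
        simpa using ((hasDerivAt_id s).const_mul 2).smul_const (Ξ 0)
      exact (hX s).sub (h1.const_add _)
    have := norm_sub_le_of_norm_deriv_le_add_integrable (c := 2 * (9 * A₁ * K * ε))
      (h := fun t => ε * (6 * A₀) * h t) hY (by fun_prop) (h_int.const_mul _)
      (fun t => mul_nonneg (by positivity) (h_nonneg t)) (by
        intro s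
        have hsplit : ∇ (hamiltonian b ε (X s)) (Ξ s) - (2 : ℝ) • Ξ 0 =
            (2 : ℝ) • (Ξ s - Ξ 0) + ε • ∇ (quadForm b (X s)) (Ξ s) := by
          rw [gradient_hamiltonian_right hb]
          module
        rw [hsplit]
        refine (norm_add_le _ _).trans (add_le_add ?_ ?_)
        · rw [norm_smul, Real.norm_ofNat]
          gcongr
          exact hΞ' s
        rw [norm_smul, Real.norm_of_nonneg hε]
        calc ε * ‖∇ (quadForm b (X s)) (Ξ s)‖
            ≤ ε * (A₀ * h s * (2 * 3)) := by
              gcongr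
              refine (norm_gradient_quadForm_right_le _ _ _).trans ?_
              gcongr
              · exact mul_nonneg hA₀0 (h_nonneg s)
              · refine (hA₀ _).trans ?_
                gcongr
                exact hjh s
              · exact hΞhi s
          _ = _ := by ring) 0 t
    have hK0 : 0 ≤ K := h_integral ▸ integral_nonneg h_nonneg
    rw [integral_const_mul, h_integral] at this
    calc ‖X t - (X 0 + (2 * t) • Ξ 0)‖
        ≤ 2 * (9 * A₁ * K * ε) * |t| + ε * (6 * A₀) * K := by simpa using this
      _ ≤ 2 * (9 * A₁ * K * ε) * jbr t + ε * (6 * A₀) * K * jbr t := by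
          refine add_le_add ?_ (le_mul_of_one_le_right (by positivity) (one_le_jbr t))
          gcongr
          exact abs_le_jbr t
      _ = _ := by ring

/-- **Proposition III.4.1.** There are `ε₀ > 0` and `C > 0`, depending only on `n, σ₀`
and finitely many of the constants `A_ℓ`, such that for `ε ∈ (0,ε₀)` and every `(x,ξ)`
with `1/2 ≤ |ξ| ≤ 2`: (i) `s ↦ ⟨x(s,x,ξ)⟩^{−(1+σ₀)}` is integrable on `ℝ`;
(ii) for all `t`, `|x(t,x,ξ) − x − 2tξ| ≤ Cε⟨t⟩` and `|ξ(t,x,ξ) − ξ| ≤ Cε`. -/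
theorem statement7
    (n : ℕ) (hn : 1 ≤ n) (σ₀ : ℝ) (hσ₀ : 0 < σ₀) (hσ₀' : σ₀ < 1)
    (A : ℕ → ℝ) (hApos : ∀ ℓ, 0 < A ℓ) :
    ∃ ε₀ C : ℝ, 0 < ε₀ ∧ 0 < C ∧
      ∀ b : Fin n → Fin n → Eu n → ℝ,
        (∀ j k, ContDiff ℝ (⊤ : ℕ∞) (b j k)) →
        (∀ (ℓ : ℕ) (x : Eu n),
          (∑ γ ∈ Finset.Nat.antidiagonalTuple n ℓ, ∑ j, ∑ k, |mderiv γ (b j k) x|) ≤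
            A ℓ * jb x ^ (-(1 + (ℓ : ℝ) + σ₀))) →
      ∀ ε : ℝ, 0 < ε → ε < ε₀ → ε * A 0 ≤ 1 / 10 →
      ∀ p : Eu n → Eu n → ℝ,
        (∀ x ξ, p x ξ = ‖ξ‖ ^ 2 + ε * ∑ j, ∑ k, b j k x * ξ j * ξ k) →
      ∀ Xf Ξf : ℝ → Eu n → Eu n → Eu n,
        ContDiff ℝ (⊤ : ℕ∞)
          (fun q : ℝ × Eu n × Eu n => (Xf q.1 q.2.1 q.2.2, Ξf q.1 q.2.1 q.2.2)) →
        (∀ (t : ℝ) (x ξ : Eu n) (j : Fin n),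
          HasDerivAt (fun s => Xf s x ξ j)
            (fderiv ℝ (fun η => p (Xf t x ξ) η) (Ξf t x ξ)
              (EuclideanSpace.single j 1)) t) →
        (∀ (t : ℝ) (x ξ : Eu n) (j : Fin n),
          HasDerivAt (fun s => Ξf s x ξ j)
            (-(fderiv ℝ (fun y => p y (Ξf t x ξ)) (Xf t x ξ)
              (EuclideanSpace.single j 1))) t) →
        (∀ x ξ, Xf 0 x ξ = x) → (∀ x ξ, Ξf 0 x ξ = ξ) →
      ∀ x ξ : Eu n, 1 / 2 ≤ ‖ξ‖ → ‖ξ‖ ≤ 2 →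
        Integrable (fun s : ℝ => jb (Xf s x ξ) ^ (-(1 + σ₀))) ∧
        ∀ t : ℝ,
          ‖Xf t x ξ - (x + (2 * t) • ξ)‖ ≤ C * ε * jbr t ∧
          ‖Ξf t x ξ - ξ‖ ≤ C * ε := by
  set K := ∫ s, jbr (1 / 12 * s) ^ (-(1 + σ₀)) with hK
  have hA₀ := hApos 0
  have hA₁ := hApos 1
  have hK0 : 0 ≤ K := integral_nonneg fun s =>
    Real.rpow_nonneg (zero_le_one.trans (one_le_jbr _)) _
  refine ⟨1 / (10 * A 1), (18 * A 1 + 6 * A 0) * K + 1, by positivity, by positivity, ?_⟩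
  intro b hb hbA ε hε hεlt hεA p hp Xf Ξf _ hX hΞ hX0 hΞ0 x ξ hlo hhi
  obtain rfl : p = hamiltonian b ε := funext fun x => funext fun ξ => hp x ξ
  have hderiv : ∀ (Y : ℝ → Eu n) (v : Eu n) (t : ℝ),
      (∀ j, HasDerivAt (fun s => Y s j) (v j) t) → HasDerivAt Y v t := by
    intro Y v t h
    have h1 : HasDerivAt (fun s => (Y s).ofLp) v.ofLp t := hasDerivAt_pi.2 h
    exact (PiLp.continuousLinearEquiv 2 ℝ fun _ : Fin n => ℝ).symm.hasFDerivAt.comp_hasDerivAt t h1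
  have hεA₁ : ε * A 1 ≤ 1 / 10 := by
    rw [lt_div_iff₀ (by positivity)] at hεlt
    linarith
  have hbA₀ : ∀ y, ∑ j, ∑ k, |b j k y| ≤ A 0 * jb y ^ (-(1 + σ₀)) := fun y => by
    simpa [Finset.Nat.antidiagonalTuple_zero_right, mderiv_zero] using hbA 0 y
  have hbA₁ : ∀ y, ∑ i, ∑ j, ∑ k, |pd i (b j k) y| ≤ A 1 * jb y ^ (-(2 + σ₀)) := fun y => by
    refine (sum_pd_le_sum_mderiv b y).trans ((hbA 1 y).trans_eq ?_)
    norm_num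
  obtain ⟨h1, h2, h3⟩ := bicharacteristic_bounds (X := fun t => Xf t x ξ)
    (Ξ := fun t => Ξf t x ξ) hσ₀
    (fun j k => (hb j k).differentiable (by simp)) hbA₀ hbA₁ hA₀.le hA₁.le hε.le hεA hεA₁
    (fun t => hderiv _ _ _ fun j => by rw [gradient_apply]; exact hX t x ξ j)
    (fun t => hderiv _ _ _ fun j => by rw [PiLp.neg_apply, gradient_apply]; exact hΞ t x ξ j)
    (by rwa [hΞ0]) (by rwa [hΞ0])
  rw [← hK, hΞ0] at h2 h3
  rw [hX0] at h3
  refine ⟨h1, fun t => ⟨(h3 t).trans ?_, (h2 t).trans ?_⟩⟩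
  · have := one_le_jbr t
    gcongr
    linarith
  · gcongr
    nlinarith [mul_nonneg hA₁.le hK0, mul_nonneg hA₀.le hK0]

end Paper
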